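/- Let n be a nonnegative integer, let j be an integer with 0 ≤ j ≤ n, and let μ ∈ ℂ satisfy 2μ + t ≠ 0 for every integer t with 0 ≤ t ≤ 2n. Then Σ_{ℓ=j}^{n} binom(n−j, ℓ−j) · ((2μ+2ℓ)/(2μ+ℓ+j)_{n−j+1}) = (μ+1/2)_j / (μ+1/2)_n. -/

import Mathlib

open scoped BigOperators

noncomputable section

/-- Ascending Pochhammer symbol `(a)_n = a (a+1) ⋯ (a+n-1)`. -/
def aP (n : ℕ) (a : ℂ) : ℂ := (ascPochhammer ℂ n).eval a

lemma aP_zero (a : ℂ) : aP 0 a = 1 := by simp [aP]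

lemma aP_succ (n : ℕ) (a : ℂ) : aP (n + 1) a = aP n a * (a + n) := by
  simp [aP, ascPochhammer_succ_eval]

lemma aP_succ' (n : ℕ) (a : ℂ) : aP (n + 1) a = a * aP n (a + 1) := by
  simp [aP, ascPochhammer_succ_left, Polynomial.eval_comp]

lemma aP_add (m n : ℕ) (a : ℂ) : aP (m + n) a = aP m a * aP n (a + m) := by
  simp [aP, ← ascPochhammer_mul, Polynomial.eval_comp]

lemma aP_ne_zero {n : ℕ} {a : ℂ} (h : ∀ i < n, a + (i : ℂ) ≠ 0) : aP n a ≠ 0 := by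
  induction n with
  | zero => simp [aP_zero]
  | succ n ih =>
    rw [aP_succ]
    exact mul_ne_zero (ih fun i hi => h i (by omega)) (h n (by omega))

/-- The Wilf–Zeilberger certificate of `sum_choose_mul_div_aP`, in partial-sum form. -/
lemma sum_range_wz (N : ℕ) (a : ℂ) (ha : ∀ t : ℕ, t ≤ 2 * (N + 1) → a + (t : ℂ) ≠ 0)
    (M : ℕ) (hM : M ≤ N + 1) :
    ∑ k ∈ Finset.range (M + 1),
        ((a + 1 + 2 * N) * (((N + 1).choose k : ℂ) * ((a + 2 * k) / aP (N + 2) (a + k))) -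
          2 * ((N.choose k : ℂ) * ((a + 2 * k) / aP (N + 1) (a + k)))) =
      -((N.choose M : ℂ) * (a + 2 * M + 1) / aP (N + 1) (a + M + 1)) := by
  have key : ∀ M : ℕ, M ≤ N + 1 → aP N (a + M + 1) ≠ 0 ∧ a + M ≠ 0 ∧ a + M + 1 + N ≠ 0 := by
    intro M hM
    refine ⟨aP_ne_zero fun i hi => ?_, ha M (by omega), ?_⟩
    · have := ha (M + 1 + i) (by omega)
      push_cast at this
      rwa [← add_assoc, ← add_assoc] at this
    · have := ha (M + 1 + N) (by omega)
      push_cast at this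
      rwa [← add_assoc, ← add_assoc] at this
  induction M with
  | zero =>
    obtain ⟨h1, h2, h3⟩ := key 0 hM
    simp only [zero_add, Finset.sum_range_one, Nat.choose_zero_right, Nat.cast_zero, Nat.cast_one, add_zero,
      mul_zero] at h1 h2 h3 ⊢
    rw [aP_succ' (N + 1) a, aP_succ' N a, aP_succ N (a + 1)]
    field_simp
    ring
  | succ M ih =>
    obtain ⟨h1, h2, h3⟩ := key (M + 1) hM
    rw [Finset.sum_range_succ, ih (by omega), aP_succ' (N + 1), aP_succ' N, aP_succ N]
    have hc : (N.choose (M + 1) : ℂ) * (M + 1) = N.choose M * (N - M) := by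
      have := Nat.choose_succ_right_eq N M
      rw [← Nat.cast_sub (by omega : M ≤ N)]
      exact_mod_cast this
    rw [Nat.choose_succ_succ, add_assoc a (M : ℂ) 1, aP_succ' N]
    push_cast at *
    generalize aP N (a + (M + 1) + 1) = Q at *
    field_simp
    linear_combination (-(a + 2 * M + 3)) * hc

lemma sum_choose_mul_div_aP (N : ℕ) (a : ℂ) (ha : ∀ t : ℕ, t ≤ 2 * N → a + (t : ℂ) ≠ 0) :
    ∑ k ∈ Finset.range (N + 1), (N.choose k : ℂ) * ((a + 2 * k) / aP (N + 1) (a + k)) =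
      1 / aP N ((a + 1) / 2) := by
  induction N with
  | zero =>
    have := ha 0 le_rfl
    simp_all [aP_zero, aP_succ]
  | succ N ih =>
    have hwz := sum_range_wz N a ha (N + 1) le_rfl
    have hN : a + 1 + 2 * N ≠ 0 := by
      have := ha (2 * N + 1) (by omega)
      push_cast at this
      rwa [add_comm (2 * (N : ℂ)), ← add_assoc] at this
    rw [Finset.sum_sub_distrib, ← Finset.mul_sum, ← Finset.mul_sum,
      Finset.sum_range_succ (fun k => (N.choose k : ℂ) * _) (N + 1),
      ih fun t ht => ha t (by omega)] at hwz
    simp only [Nat.choose_succ_self, Nat.cast_zero, zero_mul, add_zero, zero_div, neg_zero] at hwz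
    rw [aP_succ, show (a + 1) / 2 + N = (a + 1 + 2 * N) / 2 by ring, ← mul_right_inj' hN,
      sub_eq_zero.mp hwz]
    field_simp

/-- A Pochhammer summation identity with a shift `j`. -/
theorem pochhammer_binomial_sum_shifted (n j : ℕ) (hj : j ≤ n) (μ : ℂ)
    (hμ : ∀ t : ℕ, t ≤ 2 * n → 2 * μ + (t : ℂ) ≠ 0) :
    ∑ ℓ ∈ Finset.Icc j n,
        ((n - j).choose (ℓ - j) : ℂ) * ((2 * μ + 2 * ℓ) / aP (n - j + 1) (2 * μ + ℓ + j)) =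
      aP j (μ + 1 / 2) / aP n (μ + 1 / 2) := by
  obtain ⟨N, rfl⟩ := Nat.exists_eq_add_of_le hj
  have hj0 : aP j (μ + 1 / 2) ≠ 0 := aP_ne_zero fun i hi h0 => by
    refine hμ (2 * i + 1) (by omega) ?_
    push_cast
    linear_combination 2 * h0
  have hsum := sum_choose_mul_div_aP N (2 * μ + 2 * j) fun t ht h0 => by
    refine hμ (2 * j + t) (by omega) ?_
    push_cast
    linear_combination h0
  rw [aP_add, div_mul_cancel_left₀ hj0, ← one_div,
    show μ + 1 / 2 + (j : ℂ) = (2 * μ + 2 * j + 1) / 2 by ring, ← hsum,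
    ← Finset.Ico_succ_right_eq_Icc, Finset.sum_Ico_eq_sum_range]
  simp only [Order.succ_eq_add_one, add_tsub_cancel_left,
    show j + N + 1 - j = N + 1 by omega]
  refine Finset.sum_congr rfl fun k _ => ?_
  push_cast
  ring_nf
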